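/- arXiv:1912.11542 — 4 statements merged into one kernel-verified Lean document; each statement's English description precedes it below -/
import Mathlib

section
/- Let m ≥ 1, M > 0, let A be a subset of {1, …, m}, and let λ₀ be a partition of A. Then the sum of p_m(ρ) over all partitions ρ of {1, …, m} whose restriction to A equals λ₀ is p_{|A|}(λ₀); that is, Σ_{ρ : ρ|_A = λ₀} p_m(ρ) = p_{|A|}(λ₀). (This is the key marginalization identity, generalizing the addition rule, underlying Proposition 2 of the paper.) -/
open Finset

noncomputable section

/-- CRP(M) probability of a partition of a finite set `s` of `n = s.card` elements:
`p_n(ρ) = M^k ∏_j (|S_j| - 1)! / ∏_{i=1}^n (M + i - 1)`. -/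
def crp {α : Type*} [DecidableEq α] (M : ℝ) {s : Finset α} (P : Finpartition s) : ℝ :=
  (M ^ P.parts.card * ∏ b ∈ P.parts, (Nat.factorial (b.card - 1) : ℝ)) /
    ∏ i ∈ Finset.range s.card, (M + i)

/-- Restriction of a partition of `s` to a subset `A ⊆ s`: the clusters are the
nonempty intersections of the clusters with `A`. -/
def restrictPart {α : Type*} [DecidableEq α] {s : Finset α} (P : Finpartition s)
    (A : Finset α) (hA : A ⊆ s) : Finpartition A :=
  Finpartition.ofErase (P.parts.image (· ∩ A))
    (by
      rw [Finset.supIndep_iff_pairwiseDisjoint]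
      rintro x hx y hy hxy
      simp only [coe_image, Set.mem_image, mem_coe] at hx hy
      obtain ⟨p, hp, rfl⟩ := hx
      obtain ⟨q, hq, rfl⟩ := hy
      have hpq : p ≠ q := by rintro rfl; exact hxy rfl
      exact (P.disjoint hp hq hpq).mono inter_subset_left inter_subset_left)
    (by
      rw [Finset.sup_image]
      have : (P.parts.sup (id ∘ (· ∩ A))) = P.parts.sup id ⊓ A := by
        rw [Finset.sup_inf_distrib_right]
        rfl
      rw [this, P.sup_parts]
      exact inf_eq_right.mpr hA)

/-- The set `S(γ) = {i : γ i = 1}`. -/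
def gammaSet {m : ℕ} (γ : Fin m → Bool) : Finset (Fin m) :=
  Finset.univ.filter (fun i => γ i = true)

/-- The one-step tRPM transition kernel `K_α(ρ, λ)`. -/
def tK {m : ℕ} (M a : ℝ) (ρ lam : Finpartition (Finset.univ : Finset (Fin m))) : ℝ :=
  ∑ γ : Fin m → Bool,
    (∏ i, if γ i then a else 1 - a) *
      (if restrictPart lam (gammaSet γ) (Finset.subset_univ _) =
          restrictPart ρ (gammaSet γ) (Finset.subset_univ _) then 1 else 0) *
      (crp M lam / crp M (restrictPart lam (gammaSet γ) (Finset.subset_univ _)))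

end


section helpers

variable {α : Type*} [DecidableEq α]

lemma mem_restrictPart {s : Finset α} (P : Finpartition s) (A : Finset α) (hA : A ⊆ s)
    (b : Finset α) :
    b ∈ (restrictPart P A hA).parts ↔ b ≠ ∅ ∧ ∃ p ∈ P.parts, p ∩ A = b := by
  simp [restrictPart, Finpartition.ofErase]

lemma restrict_restrict {s t A : Finset α} (P : Finpartition s) (ht : t ⊆ s) (hA : A ⊆ t) :
    restrictPart (restrictPart P t ht) A hA = restrictPart P A (hA.trans ht) := by
  apply Finpartition.ext
  ext b
  simp only [mem_restrictPart]
  constructor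
  · rintro ⟨hb, q, ⟨hq, p, hp, rfl⟩, rfl⟩
    refine ⟨hb, p, hp, ?_⟩
    rw [inter_assoc, inter_eq_right.mpr hA]
  · rintro ⟨hb, p, hp, rfl⟩
    have e : p ∩ t ∩ A = p ∩ A := by rw [inter_assoc, inter_eq_right.mpr hA]
    refine ⟨hb, p ∩ t, ⟨?_, p, hp, rfl⟩, e⟩
    intro h
    rw [h] at e
    exact hb (by rw [← e]; simp)

lemma restrict_self {s : Finset α} (P : Finpartition s) :
    restrictPart P s (Subset.refl s) = P := by
  apply Finpartition.ext
  ext b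
  simp only [mem_restrictPart]
  constructor
  · rintro ⟨hb, p, hp, rfl⟩
    rwa [inter_eq_left.mpr (P.subset hp)]
  · intro h
    exact ⟨P.ne_empty h, b, h, inter_eq_left.mpr (P.subset h)⟩

/-- Add `a` to the cluster `c` of `P` (a new cluster if `c = ∅`). -/
def addTo {s : Finset α} {a : α} (ha : a ∉ s) (P : Finpartition s) (c : Finset α)
    (hc : c ∈ insert ∅ P.parts) : Finpartition (insert a s) :=
  Finpartition.ofExistsUnique (insert (insert a c) (P.parts.erase c))
    (by
      intro p hp
      have hcs : c ⊆ s := by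
        rcases mem_insert.mp hc with rfl | h
        · simp
        · exact P.subset h
      rcases mem_insert.mp hp with rfl | h
      · exact insert_subset_insert _ hcs
      · exact (P.subset (mem_of_mem_erase h)).trans (subset_insert _ _))
    (by
      have hcs : c ⊆ s := by
        rcases mem_insert.mp hc with rfl | h
        · simp
        · exact P.subset h
      intro x hx
      by_cases hxa : x = a
      · subst hxa
        refine ⟨insert x c, ⟨by simp, by simp⟩, ?_⟩
        rintro t ⟨ht, hxt⟩
        rcases mem_insert.mp ht with rfl | h
        · rfl
        · exact absurd (P.subset (mem_of_mem_erase h) hxt) ha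
      · have hxs : x ∈ s := by simpa [hxa] using hx
        by_cases hxc : x ∈ c
        · refine ⟨insert a c, ⟨by simp, by simp [hxc]⟩, ?_⟩
          rintro t ⟨ht, hxt⟩
          rcases mem_insert.mp ht with rfl | h
          · rfl
          · have hcP : c ∈ P.parts := by
              rcases mem_insert.mp hc with rfl | h
              · simp at hxc
              · exact h
            exact absurd (P.eq_of_mem_parts (mem_of_mem_erase h) hcP hxt hxc) (ne_of_mem_erase h)
        · obtain ⟨t, ht, hxt⟩ := P.exists_mem hxs
          refine ⟨t, ⟨?_, hxt⟩, ?_⟩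
          · refine mem_insert_of_mem (mem_erase.mpr ⟨?_, ht⟩)
            rintro rfl; exact hxc hxt
          · rintro u ⟨hu, hxu⟩
            rcases mem_insert.mp hu with rfl | h
            · simp [hxa, hxc] at hxu
            · exact P.eq_of_mem_parts (mem_of_mem_erase h) ht hxu hxt)
    (by
      intro h
      rcases mem_insert.mp h with h | h
      · exact (insert_ne_empty a c) h.symm
      · exact P.empty_notMem_parts (mem_of_mem_erase h))

lemma addTo_parts {s : Finset α} {a : α} (ha : a ∉ s) (P : Finpartition s) (c : Finset α)
    (hc : c ∈ insert ∅ P.parts) :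
    (addTo ha P c hc).parts = insert (insert a c) (P.parts.erase c) := rfl

lemma cluster_subset {s : Finset α} (P : Finpartition s) {c : Finset α}
    (hc : c ∈ insert ∅ P.parts) : c ⊆ s := by
  rcases mem_insert.mp hc with rfl | h
  · simp
  · exact P.subset h

lemma restrict_addTo {s : Finset α} {a : α} (ha : a ∉ s) (P : Finpartition s) (c : Finset α)
    (hc : c ∈ insert ∅ P.parts) :
    restrictPart (addTo ha P c hc) s (subset_insert a s) = P := by
  have hcs := cluster_subset P hc
  have e : insert a c ∩ s = c := by
    rw [insert_inter_of_notMem ha, inter_eq_left.mpr hcs]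
  apply Finpartition.ext
  ext b
  simp only [mem_restrictPart, addTo_parts]
  constructor
  · rintro ⟨hb, p, hp, rfl⟩
    rcases mem_insert.mp hp with rfl | h
    · rw [e] at hb ⊢
      exact (mem_insert.mp hc).resolve_left hb
    · have h := mem_of_mem_erase h
      rwa [inter_eq_left.mpr (P.subset h)]
  · intro h
    refine ⟨P.ne_empty h, ?_⟩
    by_cases hbc : b = c
    · exact ⟨insert a c, by simp, by rw [e, hbc]⟩
    · exact ⟨b, by simp [hbc, h], inter_eq_left.mpr (P.subset h)⟩

lemma part_addTo {s : Finset α} {a : α} (ha : a ∉ s) (P : Finpartition s) (c : Finset α)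
    (hc : c ∈ insert ∅ P.parts) :
    (addTo ha P c hc).part a ∩ s = c := by
  have hcs := cluster_subset P hc
  rw [(addTo ha P c hc).part_eq_of_mem (t := insert a c) (by simp [addTo_parts]) (by simp),
    insert_inter_of_notMem ha, inter_eq_left.mpr hcs]

lemma part_mem_insert {s : Finset α} {a : α} (Q : Finpartition (insert a s)) :
    Q.part a ∩ s ∈ insert ∅ (restrictPart Q s (subset_insert a s)).parts := by
  rw [mem_insert, mem_restrictPart]
  by_cases h : Q.part a ∩ s = ∅
  · exact Or.inl h
  · exact Or.inr ⟨h, Q.part a, by simp, rfl⟩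

lemma addTo_restrict {s : Finset α} {a : α} (ha : a ∉ s) (Q : Finpartition (insert a s)) :
    addTo ha (restrictPart Q s (subset_insert a s)) (Q.part a ∩ s) (part_mem_insert Q) = Q := by
  have haQ : a ∈ Q.part a := by simp
  have hQ : Q.part a ∈ Q.parts := by simp
  have e : insert a (Q.part a ∩ s) = Q.part a := by
    ext x
    have := @Finpartition.part_subset _ _ _ Q a x
    simp only [mem_insert, mem_inter] at this ⊢
    constructor
    · rintro (rfl | h)
      · exact haQ
      · exact h.1
    · intro h
      rcases this h with h' | h'
      · exact Or.inl h'
      · exact Or.inr ⟨h, h'⟩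
  have other : ∀ p ∈ Q.parts, p ≠ Q.part a → p ∩ s = p := by
    intro p hp hne
    rw [inter_eq_left]
    intro x hx
    rcases mem_insert.mp (Q.subset hp hx) with rfl | h
    · exact absurd (Q.part_eq_of_mem hp hx).symm hne
    · exact h
  apply Finpartition.ext
  ext b
  rw [addTo_parts, e, mem_insert, mem_erase, mem_restrictPart]
  constructor
  · rintro (rfl | ⟨hne, hb, p, hp, rfl⟩)
    · exact hQ
    · rw [other p hp (by rintro rfl; exact hne rfl)]
      exact hp
  · intro hb
    by_cases h : b = Q.part a
    · exact Or.inl h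
    · refine Or.inr ⟨?_, Q.ne_empty hb, b, hb, other b hb h⟩
      intro hbc
      obtain ⟨x, hx⟩ := Q.nonempty_of_mem_parts hb
      exact h (Q.eq_of_mem_parts hb hQ hx (mem_inter.mp (hbc ▸ hx)).1)

lemma crp_addTo_empty {s : Finset α} {a : α} (ha : a ∉ s) (M : ℝ) (hM : 0 < M)
    (P : Finpartition s) (hc : ∅ ∈ insert ∅ P.parts) :
    crp M (addTo ha P ∅ hc) = crp M P * (M / (M + s.card)) := by
  have hn : insert a (∅ : Finset α) ∉ P.parts := fun h => ha (P.subset h (by simp))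
  unfold crp
  rw [addTo_parts, erase_eq_of_notMem P.empty_notMem_parts, card_insert_of_notMem hn,
    prod_insert hn, card_insert_of_notMem ha, prod_range_succ]
  simp only [card_insert_of_notMem (notMem_empty a), card_empty]
  rw [div_mul_div_comm]
  congr 1
  simp [pow_succ]
  ring

lemma crp_addTo_mem {s : Finset α} {a : α} (ha : a ∉ s) (M : ℝ) (hM : 0 < M)
    (P : Finpartition s) (c : Finset α) (hcP : c ∈ P.parts) (hc : c ∈ insert ∅ P.parts) :
    crp M (addTo ha P c hc) = crp M P * (c.card / (M + s.card)) := by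
  have hn : insert a c ∉ P.parts.erase c :=
    fun h => ha (P.subset (mem_of_mem_erase h) (by simp))
  have hac : a ∉ c := fun h => ha (P.subset hcP h)
  have hpos : 0 < c.card := card_pos.mpr (P.nonempty_of_mem_parts hcP)
  unfold crp
  rw [addTo_parts, card_insert_of_notMem hn, card_erase_add_one hcP,
    prod_insert hn, card_insert_of_notMem ha, prod_range_succ, card_insert_of_notMem hac,
    ← mul_prod_erase P.parts _ hcP, div_mul_div_comm]
  congr 1
  rw [Nat.add_sub_cancel, ← Nat.mul_factorial_pred hpos.ne']
  push_cast
  ring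

lemma crp_addTo {s : Finset α} {a : α} (ha : a ∉ s) (M : ℝ) (hM : 0 < M)
    (P : Finpartition s) (c : Finset α) (h : c ∈ insert ∅ P.parts) :
    crp M (addTo ha P c h) =
      crp M P * ((if c = ∅ then M else (c.card : ℝ)) / (M + s.card)) := by
  split_ifs with h0
  · subst h0
    exact crp_addTo_empty ha M hM P h
  · exact crp_addTo_mem ha M hM P c ((mem_insert.mp h).resolve_left h0) h

lemma one_step {s : Finset α} {a : α} (ha : a ∉ s) (M : ℝ) (hM : 0 < M)
    (P : Finpartition s) :
    ∑ Q : Finpartition (insert a s),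
      (if restrictPart Q s (subset_insert a s) = P then crp M Q else 0) = crp M P := by
  rw [← sum_filter]
  have key : ∑ Q : Finpartition (insert a s) with restrictPart Q s (subset_insert a s) = P,
      crp M Q = ∑ c ∈ insert ∅ P.parts,
        crp M P * ((if c = ∅ then M else (c.card : ℝ)) / (M + s.card)) := by
    refine sum_bij' (fun Q _ => Q.part a ∩ s) (fun c hc => addTo ha P c hc) ?_ ?_ ?_ ?_ ?_
    · intro Q hQ
      obtain rfl := (mem_filter.mp hQ).2
      exact part_mem_insert Q
    · intro c hc
      simp [restrict_addTo]
    · intro Q hQ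
      obtain rfl := (mem_filter.mp hQ).2
      exact addTo_restrict ha Q
    · intro c hc
      exact part_addTo ha P c hc
    · intro Q hQ
      obtain rfl := (mem_filter.mp hQ).2
      conv_lhs => rw [← addTo_restrict ha Q]
      exact crp_addTo ha M hM _ _ _
  rw [key, ← mul_sum, ← sum_div, sum_insert P.empty_notMem_parts]
  have : ∑ c ∈ P.parts, (if c = ∅ then M else (c.card : ℝ)) = s.card := by
    rw [← P.sum_card_parts]
    push_cast
    exact sum_congr rfl fun c hc => if_neg (P.ne_empty hc)
  rw [this, if_pos rfl, div_self (by positivity), mul_one]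

lemma marginal (M : ℝ) (hM : 0 < M) {A : Finset α} (L : Finpartition A) (n : ℕ) :
    ∀ (s : Finset α) (hA : A ⊆ s), (s \ A).card = n →
      ∑ Q : Finpartition s, (if restrictPart Q A hA = L then crp M Q else 0) = crp M L := by
  induction n with
  | zero =>
    intro s hA h
    obtain rfl : A = s := hA.antisymm (by simpa using h)
    simp [restrict_self]
  | succ n ih =>
    intro s hA h
    obtain ⟨a, has⟩ : (s \ A).Nonempty := card_pos.mp (by omega)
    obtain ⟨has, haA⟩ := mem_sdiff.mp has
    obtain ⟨t, hat, rfl⟩ : ∃ t, a ∉ t ∧ insert a t = s :=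
      ⟨s.erase a, by simp, insert_erase has⟩
    have hAt : A ⊆ t := (subset_insert_iff_of_notMem haA).mp hA
    have hcard : (t \ A).card = n := by
      rw [insert_sdiff_of_notMem _ haA, card_insert_of_notMem (by simp [hat])] at h
      omega
    rw [← ih t hAt hcard]
    have : ∀ R : Finpartition t, (if restrictPart R A hAt = L then crp M R else 0) =
        ∑ Q : Finpartition (insert a t), if restrictPart Q t (subset_insert a t) = R then
          (if restrictPart Q A hA = L then crp M Q else 0) else 0 := by
      intro R
      rw [← one_step hat M hM R]
      split_ifs with hR
      · refine sum_congr rfl fun Q _ => ?_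
        split_ifs with h1 h2 h2
        · rfl
        · subst h1
          exact absurd ((restrict_restrict Q _ hAt).symm.trans hR) h2
        · rfl
      · symm
        refine sum_eq_zero fun Q _ => ?_
        split_ifs with h1 h2
        · subst h1
          exact absurd ((restrict_restrict Q _ hAt).trans h2) hR
        · rfl
        · rfl
    simp_rw [this]
    rw [sum_comm]
    simp

end helpers

/-- marginalization identity. For `m ≥ 1`, `M > 0`, `A ⊆ {1,…,m}` and a
partition `lam0` of `A`, summing `p_m(ρ)` over all partitions `ρ` of `{1,…,m}` whose
restriction to `A` equals `lam0` gives `p_{|A|}(lam0)`. -/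
theorem statement0 (m : ℕ) (hm : 1 ≤ m) (M : ℝ) (hM : 0 < M)
    (A : Finset (Fin m)) (lam0 : Finpartition A) :
    ∑ ρ : Finpartition (Finset.univ : Finset (Fin m)),
      (if restrictPart ρ A (Finset.subset_univ A) = lam0 then crp M ρ else 0) =
      crp M lam0 := by
  convert marginal M hM lam0 _ Finset.univ (Finset.subset_univ A) rfl
end

section
/- For every m ≥ 1 and M > 0, the CRP(M) probabilities form a probability distribution on the set of all partitions of {1, …, m}: Σ_ρ p_m(ρ) = 1, where the sum runs over all partitions ρ of {1, …, m}. -/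
open Finset

section Aux
variable {α : Type*} [DecidableEq α]

/-- Unnormalized weight. -/
noncomputable def crpW (M : ℝ) {s : Finset α} (P : Finpartition s) : ℝ :=
  M ^ P.parts.card * ∏ b ∈ P.parts, (Nat.factorial (b.card - 1) : ℝ)

/-- Add `a` to the block `t` (or as a new singleton if `t = ∅`). -/
def addPt {s : Finset α} {a : α} (ha : a ∉ s) (P : Finpartition s) (t : Finset α)
    (ht : t ∈ insert ∅ P.parts) : Finpartition (insert a s) :=
  Finpartition.ofExistsUnique (insert (insert a t) (P.parts.erase t))
    (by
      intro p hp
      have h1 : t ⊆ s := by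
        rcases mem_insert.1 ht with h | h
        · simp [h]
        · exact P.subset h
      rcases mem_insert.1 hp with h | h
      · rw [h]; exact insert_subset_insert _ h1
      · exact (P.subset (mem_of_mem_erase h)).trans (subset_insert _ _))
    (by
      intro x hx
      by_cases hxa : x = a
      · subst hxa
        refine ⟨insert x t, by simp, ?_⟩
        rintro y ⟨hy, hxy⟩
        rcases mem_insert.1 hy with h | h
        · exact h
        · exact absurd (P.subset (mem_of_mem_erase h) hxy) ha
      · have hxs : x ∈ s := (mem_insert.1 hx).resolve_left hxa
        obtain ⟨u, hu, hxu⟩ := P.exists_mem hxs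
        have key : ∀ v ∈ P.parts, x ∈ v → v = u := fun v hv hxv =>
          P.eq_of_mem_parts hv hu hxv hxu
        by_cases hxt : x ∈ t
        · have htp : t ∈ P.parts := by
            rcases mem_insert.1 ht with h | h
            · simp [h] at hxt
            · exact h
          refine ⟨insert a t, by simp [hxt], ?_⟩
          rintro y ⟨hy, hxy⟩
          rcases mem_insert.1 hy with h | h
          · exact h
          · exact absurd ((key y (mem_of_mem_erase h) hxy).trans (key t htp hxt).symm)
              (ne_of_mem_erase h)
        · refine ⟨u, ⟨mem_insert_of_mem (mem_erase.2 ⟨?_, hu⟩), hxu⟩, ?_⟩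
          · rintro rfl; exact hxt hxu
          · rintro y ⟨hy, hxy⟩
            rcases mem_insert.1 hy with h | h
            · subst h; simp [hxa, hxt] at hxy
            · exact key y (mem_of_mem_erase h) hxy)
    (by
      simp only [mem_insert, mem_erase, not_or]
      refine ⟨(insert_ne_empty _ _).symm, fun h => P.empty_notMem_parts h.2⟩)

lemma addPt_parts {s : Finset α} {a : α} (ha : a ∉ s) (P : Finpartition s) (t : Finset α)
    (ht : t ∈ insert ∅ P.parts) :
    (addPt ha P t ht).parts = insert (insert a t) (P.parts.erase t) := rfl

lemma notMem_part {s : Finset α} {a : α} (ha : a ∉ s) (P : Finpartition s) :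
    ∀ p ∈ P.parts, a ∉ p := fun _ hp h => ha (P.subset hp h)

lemma crpW_addPt {s : Finset α} {a : α} (ha : a ∉ s) (M : ℝ) (P : Finpartition s) (t : Finset α)
    (ht : t ∈ insert ∅ P.parts) :
    crpW M (addPt ha P t ht) = (if t = ∅ then M else (t.card : ℝ)) * crpW M P := by
  have hn : insert a t ∉ P.parts.erase t := fun h =>
    notMem_part ha P _ (mem_of_mem_erase h) (mem_insert_self _ _)
  unfold crpW
  rw [addPt_parts, card_insert_of_notMem hn, prod_insert hn]
  by_cases h : t = ∅
  · subst h
    rw [erase_eq_of_notMem P.empty_notMem_parts]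
    simp [pow_succ]; ring
  · have htp : t ∈ P.parts := (mem_insert.1 ht).resolve_left h
    have hat : a ∉ t := notMem_part ha P t htp
    have hc : t.card ≠ 0 := by simpa using h
    rw [card_erase_add_one htp, card_insert_of_notMem hat, if_neg h,
      ← mul_prod_erase P.parts _ htp, Nat.add_sub_cancel, ← Nat.mul_factorial_pred hc]
    push_cast; ring

/-- Remove `a`. -/
def delPt {s : Finset α} {a : α} (ha : a ∉ s) (Q : Finpartition (insert a s)) : Finpartition s :=
  (Q.avoid {a}).copy (show insert a s \ {a} = s by rw [sdiff_singleton_eq_erase, erase_insert ha])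

lemma mem_delPt {s : Finset α} {a : α} (ha : a ∉ s) (Q : Finpartition (insert a s))
    (c : Finset α) : c ∈ (delPt ha Q).parts ↔ c ≠ ∅ ∧ ∃ d ∈ Q.parts, d.erase a = c := by
  change c ∈ (Q.avoid {a}).parts ↔ _
  rw [Finpartition.mem_avoid]
  constructor
  · rintro ⟨d, hd, h, rfl⟩
    refine ⟨?_, d, hd, by simp [sdiff_singleton_eq_erase]⟩
    rwa [Ne, sdiff_eq_empty_iff_subset]
  · rintro ⟨h, d, hd, rfl⟩
    refine ⟨d, hd, ?_, by simp [sdiff_singleton_eq_erase]⟩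
    rw [← sdiff_singleton_eq_erase, Ne, sdiff_eq_empty_iff_subset] at h
    exact h

lemma sum_crpW_insert {s : Finset α} {a : α} (ha : a ∉ s) (M : ℝ) :
    ∑ Q : Finpartition (insert a s), crpW M Q
      = (M + s.card) * ∑ P : Finpartition s, crpW M P := by
  have h1 : ∀ P : Finpartition s, (M + s.card) * crpW M P =
      ∑ t ∈ insert ∅ P.parts, (if t = ∅ then M else (t.card : ℝ)) * crpW M P := by
    intro P
    rw [← sum_mul, sum_insert P.empty_notMem_parts, if_pos rfl]
    congr 2
    rw [← P.sum_card_parts]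
    push_cast
    exact sum_congr rfl fun t ht => by rw [if_neg (P.ne_empty ht)]
  rw [mul_sum, sum_congr rfl (fun P _ => h1 P), sum_sigma']
  symm
  refine sum_bij' (fun x hx => addPt ha x.1 x.2 (mem_sigma.1 hx).2)
    (fun Q _ => ⟨delPt ha Q, (Q.part a).erase a⟩) (fun _ _ => mem_univ _) ?_ ?_ ?_ ?_
  · intro Q _
    simp only [mem_sigma, mem_univ, true_and, mem_insert, mem_delPt]
    by_cases h : (Q.part a).erase a = ∅
    · exact Or.inl h
    · exact Or.inr ⟨h, Q.part a, by simp, rfl⟩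
  · rintro ⟨P, t⟩ hx
    have ht := (mem_sigma.1 hx).2
    simp only at ht
    have hat : a ∉ t := by
      rcases mem_insert.1 ht with h | h
      · simp [h]
      · exact notMem_part ha P t h
    have hp : (addPt ha P t ht).part a = insert a t :=
      Finpartition.part_eq_of_mem _ (by simp [addPt_parts]) (by simp)
    refine Sigma.ext ?_ (heq_of_eq ?_)
    · ext c
      simp only [mem_delPt, addPt_parts]
      constructor
      · rintro ⟨hc, d, hd, rfl⟩
        rcases mem_insert.1 hd with h | h
        · subst h
          rw [erase_insert hat] at hc ⊢
          exact (mem_insert.1 ht).resolve_left hc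
        · have := mem_of_mem_erase h
          rwa [erase_eq_of_notMem (notMem_part ha P d this)]
      · intro hc
        refine ⟨P.ne_empty hc, ?_⟩
        by_cases h : c = t
        · exact ⟨insert a t, by simp, by rw [erase_insert hat, h]⟩
        · exact ⟨c, by simp [h, hc], erase_eq_of_notMem (notMem_part ha P c hc)⟩
    · simp only [hp, erase_insert hat]
  · intro Q _
    have hpa : Q.part a ∈ Q.parts := by simp
    have haa : a ∈ Q.part a := by simp
    have hd : ∀ d ∈ Q.parts, d ≠ Q.part a → a ∉ d := fun d hd hne h =>
      hne (Q.eq_of_mem_parts hd hpa h haa)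
    ext c
    simp only [addPt_parts, mem_insert, mem_erase, mem_delPt, insert_erase haa]
    constructor
    · rintro (rfl | ⟨h1, h2, d, hdQ, rfl⟩)
      · exact hpa
      · have : d ≠ Q.part a := by rintro rfl; exact h1 rfl
        rwa [erase_eq_of_notMem (hd d hdQ this)]
    · intro hc
      by_cases h : c = Q.part a
      · exact Or.inl h
      · refine Or.inr ⟨?_, Q.ne_empty hc, c, hc, erase_eq_of_notMem (hd c hc h)⟩
        intro hce
        obtain ⟨x, hx⟩ := Q.nonempty_of_mem_parts hc
        have hx' : x ∈ Q.part a := mem_of_mem_erase (hce ▸ hx)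
        exact h (Q.eq_of_mem_parts hc hpa hx hx')
  · rintro ⟨P, t⟩ hx
    exact (crpW_addPt ha M P t _).symm

lemma sum_crpW (M : ℝ) (s : Finset α) :
    ∑ P : Finpartition s, crpW M P = ∏ i ∈ range s.card, (M + i) := by
  induction s using Finset.induction_on with
  | empty =>
    have h : ∀ P : Finpartition (∅ : Finset α), crpW M P = 1 := by
      intro P
      have : P.parts = ∅ := P.parts_eq_empty_iff.2 rfl
      simp [crpW, this]
    have hu : (univ : Finset (Finpartition (∅ : Finset α))) = {Finpartition.empty _} := by
      ext P
      have : P.parts = ∅ := P.parts_eq_empty_iff.2 rfl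
      simp only [mem_univ, mem_singleton, true_iff]
      exact Finpartition.ext (by rw [this]; rfl)
    rw [sum_congr rfl fun P _ => h P, hu]
    simp
  | insert a s ha ih =>
    rw [sum_crpW_insert ha, ih, card_insert_of_notMem ha, prod_range_succ, mul_comm]

end Aux

/-- for every `m ≥ 1` and `M > 0`, the CRP(M) probabilities sum to one
over all partitions of `{1, …, m}`. -/
theorem statement2 (m : ℕ) (hm : 1 ≤ m) (M : ℝ) (hM : 0 < M) :
    ∑ ρ : Finpartition (Finset.univ : Finset (Fin m)), crp M ρ = 1 := by
  have h := sum_crpW M (Finset.univ : Finset (Fin m))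
  have hpos : (0 : ℝ) < ∏ i ∈ range (Finset.univ : Finset (Fin m)).card, (M + i) :=
    prod_pos fun i _ => by positivity
  have h2 : ∀ ρ : Finpartition (Finset.univ : Finset (Fin m)), crp M ρ =
      crpW M ρ / ∏ i ∈ range (Finset.univ : Finset (Fin m)).card, (M + i) := fun _ => rfl
  rw [sum_congr rfl fun ρ _ => h2 ρ, ← sum_div, h, div_self hpos.ne']
end

section
/- (Proposition 1.) Let m ≥ 1, M > 0, T ≥ 1, and α_2, …, α_T ∈ [0,1]. Consider the temporal random partition model in which ρ_1 has pmf p_m (the CRP(M) distribution) and, for t = 2, …, T, ρ_t given ρ_{t−1} has pmf K_{α_t}(ρ_{t−1}, ·). Then for every t ∈ {1, …, T} and every partition λ of {1, …, m}, the marginal probability that ρ_t = λ, namely Σ over all sequences (ρ_1, …, ρ_{t−1}) of p_m(ρ_1) ∏_{s=2}^{t} K_{α_s}(ρ_{s−1}, ρ_s) with ρ_t = λ, equals p_m(λ); that is, ρ_1, …, ρ_T are identically distributed with the CRP(M) law. -/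
open Finset

theorem aux_mem_restrict {α : Type*} [DecidableEq α] {s : Finset α} (P : Finpartition s)
    (A : Finset α) (hA : A ⊆ s) (b : Finset α) :
    b ∈ (restrictPart P A hA).parts ↔ b ≠ ∅ ∧ ∃ p ∈ P.parts, p ∩ A = b := by
  simp [restrictPart, Finpartition.ofErase]

theorem aux_restrict_trans {α : Type*} [DecidableEq α] {s : Finset α} (P : Finpartition s)
    (A B : Finset α) (hAB : A ⊆ B) (hB : B ⊆ s) :
    restrictPart (restrictPart P B hB) A hAB = restrictPart P A (hAB.trans hB) := by
  ext b
  simp only [aux_mem_restrict]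
  constructor
  · rintro ⟨h, p, ⟨hp, q, hq, rfl⟩, rfl⟩
    refine ⟨h, q, hq, ?_⟩
    rw [inter_assoc, inter_eq_right.2 hAB]
  · rintro ⟨h, q, hq, rfl⟩
    have e : q ∩ B ∩ A = q ∩ A := by rw [inter_assoc, inter_eq_right.2 hAB]
    refine ⟨h, q ∩ B, ⟨?_, q, hq, rfl⟩, e⟩
    rintro h0
    rw [h0] at e
    exact h (by rw [← e]; simp)

theorem aux_restrict_self {α : Type*} [DecidableEq α] {s : Finset α} (P : Finpartition s)
    (h : s ⊆ s) : restrictPart P s h = P := by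
  ext b
  simp only [aux_mem_restrict]
  constructor
  · rintro ⟨h, p, hp, rfl⟩
    rwa [inter_eq_left.2 (P.le hp)]
  · intro hb
    exact ⟨(P.nonempty_of_mem_parts hb).ne_empty, b, hb, inter_eq_left.2 (P.le hb)⟩

theorem aux_crp_pos {α : Type*} [DecidableEq α] {M : ℝ} (hM : 0 < M) {s : Finset α}
    (P : Finpartition s) : 0 < crp M P := by
  unfold crp
  positivity

/-- Add `x` to the block `c` (or create a new block when `c = ∅`). -/
def auxExt {α : Type*} [DecidableEq α] {A : Finset α} (Q : Finpartition A) (x : α) (hx : x ∉ A)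
    (c : Finset α) (hc : c ∈ insert ∅ Q.parts) : Finpartition (insert x A) where
  parts := insert (insert x c) (Q.parts.erase c)
  supIndep := by
    rw [Finset.supIndep_iff_pairwiseDisjoint]
    have key : ∀ b ∈ Q.parts.erase c, Disjoint (insert x c) b := by
      intro b hb
      rw [mem_erase] at hb
      rw [disjoint_insert_left]
      refine ⟨fun h => hx (Q.le hb.2 h), ?_⟩
      rcases mem_insert.1 hc with rfl | hc
      · simp
      · exact Q.disjoint hc hb.2 hb.1.symm
    intro p hp q hq hpq
    simp only [coe_insert, Set.mem_insert_iff, mem_coe] at hp hq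
    rcases hp with rfl | hp <;> rcases hq with rfl | hq
    · exact (hpq rfl).elim
    · exact key q hq
    · exact (key p hp).symm
    · exact Q.disjoint (mem_of_mem_erase hp) (mem_of_mem_erase hq) hpq
  sup_parts := by
    have h := Q.sup_parts
    have h2 : Q.parts.sup id = c ∪ (Q.parts.erase c).sup id := by
      rcases mem_insert.1 hc with rfl | hc
      · rw [erase_eq_of_notMem Q.empty_notMem_parts]; simp
      · conv_lhs => rw [← insert_erase hc]
        simp
    rw [sup_insert]
    simp only [id, sup_eq_union, insert_union]
    exact congrArg (insert x) (h2.symm.trans h)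
  bot_notMem := by
    simp only [bot_eq_empty, mem_insert, not_or]
    exact ⟨fun h => by simpa using h.symm, fun h => Q.bot_notMem (mem_of_mem_erase h)⟩

theorem aux_crp_ext {α : Type*} [DecidableEq α] {M : ℝ} (hM : 0 < M) {A : Finset α}
    (Q : Finpartition A) (x : α) (hx : x ∉ A)
    (c : Finset α) (hc : c ∈ insert ∅ Q.parts) :
    crp M (auxExt Q x hx c hc) =
      crp M Q * ((if c = ∅ then M else (c.card : ℝ)) / (M + A.card)) := by
  have hxc : x ∉ c := by
    rcases mem_insert.1 hc with rfl | hc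
    · simp
    · exact fun h => hx (Q.le hc h)
  have hn : insert x c ∉ Q.parts.erase c := fun h =>
    hx (Q.le (mem_of_mem_erase h) (mem_insert_self _ _))
  have h1 : (M + A.card) ≠ 0 := by positivity
  have h2 : (∏ i ∈ Finset.range A.card, (M + i)) ≠ 0 := by positivity
  unfold crp
  simp only [auxExt]
  rw [card_insert_of_notMem hn, prod_insert hn, card_insert_of_notMem hx, prod_range_succ,
    card_insert_of_notMem hxc]
  rcases mem_insert.1 hc with rfl | hc
  · have : (∅ : Finset α) ∉ Q.parts := Q.bot_notMem
    rw [erase_eq_of_notMem this]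
    simp
    field_simp
    try ring
  · have hne := (Q.nonempty_of_mem_parts hc)
    have hcp := hne.card_pos
    rw [if_neg hne.ne_empty, card_erase_of_mem hc, ← mul_prod_erase _ _ hc]
    have h3 : Q.parts.card - 1 + 1 = Q.parts.card := Nat.sub_add_cancel (card_pos.2 ⟨c, hc⟩)
    rw [h3]
    have h4 : ((c.card + 1 - 1).factorial : ℝ) = c.card * (c.card - 1).factorial := by
      rw [Nat.add_sub_cancel, ← Nat.mul_factorial_pred hcp.ne']; push_cast; rfl
    rw [h4]
    field_simp

theorem aux_ext_restrict {α : Type*} [DecidableEq α] {A : Finset α}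
    (Q : Finpartition A) (x : α) (hx : x ∉ A)
    (c : Finset α) (hc : c ∈ insert ∅ Q.parts) :
    restrictPart (auxExt Q x hx c hc) A (subset_insert _ _) = Q := by
  have hcA : c ⊆ A := by
    rcases mem_insert.1 hc with rfl | hc
    · simp
    · exact Q.le hc
  have e : insert x c ∩ A = c := by
    rw [insert_inter_of_notMem hx, inter_eq_left.2 hcA]
  ext b
  simp only [aux_mem_restrict, auxExt]
  constructor
  · rintro ⟨h, p, hp, rfl⟩
    rcases mem_insert.1 hp with rfl | hp
    · rw [e] at h ⊢
      exact (mem_insert.1 hc).resolve_left h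
    · have := mem_of_mem_erase hp
      rwa [inter_eq_left.2 (Q.le this)]
  · intro hb
    refine ⟨(Q.nonempty_of_mem_parts hb).ne_empty, ?_⟩
    by_cases hbc : b = c
    · subst hbc
      exact ⟨_, mem_insert_self _ _, e⟩
    · exact ⟨b, mem_insert_of_mem (mem_erase.2 ⟨hbc, hb⟩), inter_eq_left.2 (Q.le hb)⟩

theorem aux_ext_inj {α : Type*} [DecidableEq α] {A : Finset α}
    (Q : Finpartition A) (x : α) (hx : x ∉ A)
    (c : Finset α) (hc : c ∈ insert ∅ Q.parts) (d : Finset α) (hd : d ∈ insert ∅ Q.parts)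
    (h : auxExt Q x hx c hc = auxExt Q x hx d hd) : c = d := by
  have hxA : ∀ c ∈ insert ∅ Q.parts, x ∉ c := by
    intro c hc
    rcases mem_insert.1 hc with rfl | hc
    · simp
    · exact fun h => hx (Q.le hc h)
  have h1 : insert x c ∈ (auxExt Q x hx d hd).parts := by
    rw [← h]; exact mem_insert_self _ _
  rcases mem_insert.1 h1 with h1 | h1
  · have := congrArg (fun z => z.erase x) h1
    simpa [erase_insert (hxA c hc), erase_insert (hxA d hd)] using this
  · exact (hx (Q.le (mem_of_mem_erase h1) (mem_insert_self _ _))).elim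

theorem aux_ext_surj {α : Type*} [DecidableEq α] {A : Finset α} (x : α) (hx : x ∉ A)
    (P : Finpartition (insert x A)) (Q : Finpartition A)
    (h : restrictPart P A (subset_insert _ _) = Q) :
    ∃ c, ∃ hc : c ∈ insert ∅ Q.parts, auxExt Q x hx c hc = P := by
  subst h
  obtain ⟨p, hp, hxp⟩ := P.exists_mem (mem_insert_self x A)
  have huniq : ∀ q ∈ P.parts, q ≠ p → q ∩ A = q := by
    intro q hq hqp
    rw [inter_eq_left]
    intro y hy
    refine (mem_insert.1 (P.le hq hy)).resolve_left ?_
    rintro rfl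
    exact hqp (P.eq_of_mem_parts hq hp hy hxp)
  have hpA : insert x (p ∩ A) = p := by
    ext y
    have this : y ∈ p → y ∈ insert x A := fun hy => P.subset hp hy
    simp only [mem_insert, mem_inter] at *
    constructor
    · rintro (rfl | h) <;> tauto
    · intro hy; have := this hy; tauto
  have hc : p ∩ A ∈ insert ∅ (restrictPart P A (subset_insert _ _)).parts := by
    rw [mem_insert, aux_mem_restrict]
    by_cases h0 : p ∩ A = ∅
    · exact Or.inl h0
    · exact Or.inr ⟨h0, p, hp, rfl⟩
  refine ⟨p ∩ A, hc, ?_⟩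
  ext b
  simp only [auxExt, mem_insert, mem_erase, aux_mem_restrict, hpA]
  constructor
  · rintro (rfl | ⟨h1, h2, q, hq, rfl⟩)
    · exact hp
    · have : q ≠ p := by rintro rfl; exact h1 rfl
      rwa [huniq q hq this]
  · intro hb
    by_cases hbp : b = p
    · exact Or.inl hbp
    · refine Or.inr ⟨?_, (P.nonempty_of_mem_parts hb).ne_empty, b, hb, huniq b hb hbp⟩
      intro hbe
      obtain ⟨y, hy⟩ := P.nonempty_of_mem_parts hb
      have hy2 : y ∈ p := by rw [hbe] at hy; exact (mem_inter.1 hy).1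
      exact hbp (P.eq_of_mem_parts hb hp hy hy2)

theorem aux_step {α : Type*} [DecidableEq α] {M : ℝ} (hM : 0 < M) {A : Finset α} (x : α)
    (hx : x ∉ A) (Q : Finpartition A) :
    ∑ P : Finpartition (insert x A),
      (if restrictPart P A (subset_insert _ _) = Q then crp M P else 0) = crp M Q := by
  rw [← sum_filter]
  have h1 : ∑ c ∈ (insert ∅ Q.parts).attach, crp M (auxExt Q x hx c.1 c.2) =
      ∑ P ∈ univ.filter (fun P : Finpartition (insert x A) =>
        restrictPart P A (subset_insert _ _) = Q), crp M P := by
    refine sum_bij (fun c _ => auxExt Q x hx c.1 c.2) ?_ ?_ ?_ ?_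
    · intro c _
      simp [aux_ext_restrict]
    · intro c _ d _ h
      exact Subtype.ext (aux_ext_inj Q x hx _ _ _ _ h)
    · intro P hP
      obtain ⟨c, hc, h⟩ := aux_ext_surj x hx P Q (mem_filter.1 hP).2
      exact ⟨⟨c, hc⟩, mem_attach _ _, h⟩
    · intros; rfl
  rw [← h1]
  simp only [aux_crp_ext hM]
  rw [sum_attach (insert ∅ Q.parts) (fun c => crp M Q *
    ((if c = ∅ then M else (c.card : ℝ)) / (M + A.card))), ← mul_sum, ← sum_div,
    sum_insert Q.empty_notMem_parts]
  have h2 : ∑ c ∈ Q.parts, (if c = ∅ then M else (c.card : ℝ)) = A.card := by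
    rw [← Q.sum_card_parts]
    push_cast
    refine sum_congr rfl fun c hc => ?_
    rw [if_neg (Q.nonempty_of_mem_parts hc).ne_empty]
  rw [h2]
  have h3 : (M + A.card) ≠ 0 := by positivity
  simp [h3]

theorem aux_marg {α : Type*} [DecidableEq α] {M : ℝ} (hM : 0 < M) {s : Finset α} (n : ℕ) :
    ∀ (A : Finset α) (hA : A ⊆ s) (_ : (s \ A).card = n) (Q : Finpartition A),
    ∑ P : Finpartition s, (if restrictPart P A hA = Q then crp M P else 0) = crp M Q := by
  induction n with
  | zero =>
    intro A hA h Q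
    have : A = s := hA.antisymm (sdiff_eq_empty_iff_subset.1 (card_eq_zero.1 h))
    subst this
    simp [aux_restrict_self]
  | succ n ih =>
    intro A hA h Q
    obtain ⟨x, hx⟩ : (s \ A).Nonempty := card_pos.1 (by omega)
    have hxs := (mem_sdiff.1 hx).1
    have hxA := (mem_sdiff.1 hx).2
    have hB : insert x A ⊆ s := insert_subset hxs hA
    have hcard : (s \ insert x A).card = n := by
      rw [sdiff_insert, card_erase_of_mem hx, h]; rfl
    rw [← aux_step hM x hxA Q]
    have h1 : ∀ R : Finpartition (insert x A),
        (if restrictPart R A (subset_insert _ _) = Q then crp M R else 0) =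
        ∑ P : Finpartition s, if restrictPart P (insert x A) hB = R then
          (if restrictPart P A hA = Q then crp M P else 0) else 0 := by
      intro R
      by_cases hR : restrictPart R A (subset_insert _ _) = Q
      · rw [if_pos hR, ← ih _ hB hcard R]
        refine sum_congr rfl fun P _ => ?_
        by_cases hP : restrictPart P (insert x A) hB = R
        · have : restrictPart P A hA = Q := by
            rw [← aux_restrict_trans P A (insert x A) (subset_insert _ _) hB, hP, hR]
          rw [if_pos hP, if_pos hP, if_pos this]
        · rw [if_neg hP, if_neg hP]
      · rw [if_neg hR]
        symm
        refine sum_eq_zero fun P _ => ?_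
        by_cases hP : restrictPart P (insert x A) hB = R
        · have : restrictPart P A hA ≠ Q := by
            rw [← aux_restrict_trans P A (insert x A) (subset_insert _ _) hB, hP]
            exact hR
          rw [if_pos hP, if_neg this]
        · rw [if_neg hP]
    rw [sum_congr rfl fun R _ => h1 R, sum_comm]
    refine sum_congr rfl fun P _ => ?_
    simp

theorem aux_weights (m : ℕ) (a : ℝ) :
    ∑ γ : Fin m → Bool, (∏ i, if γ i then a else 1 - a) = 1 := by
  have h := Finset.prod_univ_sum (fun _ : Fin m => (univ : Finset Bool))
    (fun _ b => if b then a else 1 - a)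
  simp only [Fintype.piFinset_univ] at h
  rw [← h]
  simp

theorem aux_invariant {m : ℕ} {M : ℝ} (hM : 0 < M) (a : ℝ)
    (lam : Finpartition (Finset.univ : Finset (Fin m))) :
    ∑ ρ, crp M ρ * tK M a ρ lam = crp M lam := by
  unfold tK
  simp only [mul_sum]
  rw [sum_comm]
  have h : ∀ γ : Fin m → Bool, ∑ ρ : Finpartition (Finset.univ : Finset (Fin m)),
      crp M ρ * ((∏ i, if γ i then a else 1 - a) *
      (if restrictPart lam (gammaSet γ) (Finset.subset_univ _) =
          restrictPart ρ (gammaSet γ) (Finset.subset_univ _) then 1 else 0) *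
      (crp M lam / crp M (restrictPart lam (gammaSet γ) (Finset.subset_univ _)))) =
      (∏ i, if γ i then a else 1 - a) * crp M lam := by
    intro γ
    set Q := restrictPart lam (gammaSet γ) (Finset.subset_univ _) with hQ
    have h1 := aux_marg hM _ (gammaSet γ) (Finset.subset_univ _) rfl Q
    have h2 := (aux_crp_pos hM Q).ne'
    calc _ = ∑ ρ, ((∏ i, if γ i then a else 1 - a) * (crp M lam / crp M Q)) *
          (if restrictPart ρ (gammaSet γ) (Finset.subset_univ _) = Q then crp M ρ else 0) := by
          refine sum_congr rfl fun ρ _ => ?_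
          by_cases hP : restrictPart ρ (gammaSet γ) (Finset.subset_univ _) = Q
          · rw [if_pos hP, if_pos hP.symm]; ring
          · rw [if_neg hP, if_neg (Ne.symm hP)]; ring
      _ = _ := by
          rw [← mul_sum, h1]
          field_simp
  rw [sum_congr rfl fun γ _ => h γ, ← sum_mul, aux_weights, one_mul]

theorem aux_main {m : ℕ} {M : ℝ} (hM : 0 < M) (a : ℕ → ℝ) (t' : ℕ) :
    ∀ (lam : Finpartition (Finset.univ : Finset (Fin m))),
    ∑ r : Fin (t' + 1) → Finpartition (Finset.univ : Finset (Fin m)),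
      (if r (Fin.last t') = lam then 1 else 0) *
        (crp M (r 0) * ∏ s : Fin t', tK M (a (s.1 + 2)) (r s.castSucc) (r s.succ)) =
      crp M lam := by
  induction t' with
  | zero =>
    intro lam
    rw [← (Equiv.funUnique (Fin 1) (Finpartition (Finset.univ : Finset (Fin m)))).symm.sum_comp]
    simp
  | succ t ih =>
    intro lam
    rw [← (Fin.snocEquiv (fun _ : Fin (t + 2) =>
      Finpartition (Finset.univ : Finset (Fin m)))).sum_comp, Fintype.sum_prod_type]
    rw [← aux_invariant hM (a (t + 2)) lam]
    rw [sum_comm]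
    have h : ∀ r : Fin (t + 1) → Finpartition (Finset.univ : Finset (Fin m)), 
        (∑ x, (if (Fin.snocEquiv (fun _ : Fin (t + 2) =>
      Finpartition (Finset.univ : Finset (Fin m))) (x, r)) (Fin.last (t+1)) = lam then 1 else 0) *
        (crp M ((Fin.snocEquiv (fun _ : Fin (t + 2) =>
      Finpartition (Finset.univ : Finset (Fin m))) (x, r)) 0) * ∏ s : Fin (t+1), tK M (a (s.1 + 2)) ((Fin.snocEquiv (fun _ : Fin (t + 2) =>
      Finpartition (Finset.univ : Finset (Fin m))) (x, r)) s.castSucc) ((Fin.snocEquiv (fun _ : Fin (t + 2) =>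
      Finpartition (Finset.univ : Finset (Fin m))) (x, r)) s.succ))) = 
        (crp M (r 0) * ∏ s : Fin t, tK M (a (s.1 + 2)) (r s.castSucc) (r s.succ)) *
          tK M (a (t + 2)) (r (Fin.last t)) lam := by
      intro r
      rw [sum_eq_single lam]
      · rw [Fin.prod_univ_castSucc]
        have e0 : (Fin.snoc r lam : Fin (t + 2) → Finpartition (Finset.univ : Finset (Fin m))) 0
            = r 0 := Fin.snoc_castSucc (α := fun _ => _) lam r 0
        simp only [Fin.snocEquiv, Equiv.coe_fn_mk, Fin.snoc_last, e0, Fin.snoc_castSucc,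
          Fin.succ_last, ← Fin.castSucc_succ, Fin.val_castSucc, Fin.val_last]
        simp
        ring
      · intro x _ hx
        simp [Fin.snocEquiv, hx]
      · simp
    rw [sum_congr rfl fun r _ => h r]
    have h5 : ∀ ρ : Finpartition (Finset.univ : Finset (Fin m)),
        crp M ρ * tK M (a (t + 2)) ρ lam =
        ∑ r : Fin (t + 1) → Finpartition (Finset.univ : Finset (Fin m)),
      ((if r (Fin.last t) = ρ then 1 else 0) *
        (crp M (r 0) * ∏ s : Fin t, tK M (a (s.1 + 2)) (r s.castSucc) (r s.succ))) *
          tK M (a (t + 2)) ρ lam := by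
      intro ρ
      rw [← sum_mul, ih ρ]
    rw [sum_congr rfl fun ρ _ => h5 ρ]
    rw [sum_comm]
    refine sum_congr rfl fun r _ => ?_
    simp [ite_mul]

/-- Proposition 1: in the temporal random partition model where `ρ_1 ∼ CRP(M)`
and `ρ_t | ρ_{t-1} ∼ K_{α_t}(ρ_{t-1}, ·)` for `t = 2, …, T`, every `ρ_t` is marginally
CRP(M)-distributed. Here time `t = t' + 1` with `1 ≤ t ≤ T`, the sequence
`(ρ_1, …, ρ_t)` is `r : Fin (t'+1) → _` (so `r 0 = ρ_1` and `r (Fin.last t') = ρ_t`),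
and the marginal probability that `ρ_t = λ` is the sum over all sequences with last
entry `λ` of `p_m(ρ_1) ∏_{s=2}^{t} K_{α_s}(ρ_{s-1}, ρ_s)`. -/
theorem statement6 (m : ℕ) (hm : 1 ≤ m) (M : ℝ) (hM : 0 < M) (T : ℕ) (hT : 1 ≤ T)
    (a : ℕ → ℝ) (ha : ∀ s, 2 ≤ s → s ≤ T → a s ∈ Set.Icc (0 : ℝ) 1)
    (t' : ℕ) (ht : t' + 1 ≤ T)
    (lam : Finpartition (Finset.univ : Finset (Fin m))) :
    ∑ r : Fin (t' + 1) → Finpartition (Finset.univ : Finset (Fin m)),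
      (if r (Fin.last t') = lam then 1 else 0) *
        (crp M (r 0) * ∏ s : Fin t', tK M (a (s.1 + 2)) (r s.castSucc) (r s.succ)) =
      crp M lam := by
  exact aux_main hM a t' lam
end

section
/- For m = 3, M = 1, and every α ∈ (0,1), conditional on the previous partition being a = {{1,2,3}}, the partition b = {{1,2},{3}} is strictly more probable than the partition e = {{1},{2},{3}} under the tRPM transition kernel: K_α(a, b) > K_α(a, e), even though b and e have equal probability under CRP(1) itself. -/
open Finset

theorem restrictPart_parts_aux {α : Type*} [DecidableEq α] {s : Finset α} (P : Finpartition s)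
    (A : Finset α) (hA : A ⊆ s) :
    (restrictPart P A hA).parts = (P.parts.image (· ∩ A)).erase ∅ := rfl

theorem crp_one_pos_aux {α : Type*} [DecidableEq α] {s : Finset α} (P : Finpartition s) :
    0 < crp (1 : ℝ) P := by
  unfold crp
  apply div_pos
  · apply mul_pos (by positivity)
    exact Finset.prod_pos fun b _ => by positivity
  · exact Finset.prod_pos fun b _ => by positivity

theorem comb_aux : ∀ A : Finset (Fin 3),
    (({{0}, {1}, {2}} : Finset (Finset (Fin 3))).image (· ∩ A)).erase ∅ =
      (({{0, 1, 2}} : Finset (Finset (Fin 3))).image (· ∩ A)).erase ∅ →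
    (({{0, 1}, {2}} : Finset (Finset (Fin 3))).image (· ∩ A)).erase ∅ =
      (({{0, 1, 2}} : Finset (Finset (Fin 3))).image (· ∩ A)).erase ∅ := by
  decide

/-- for `m = 3`, `M = 1` and `α ∈ (0,1)`, conditionally on the previous
partition being `a = {{1,2,3}}`, the partition `b = {{1,2},{3}}` is strictly more
probable than `e = {{1},{2},{3}}` under the tRPM kernel, even though `b` and `e` have
equal probability under CRP(1) itself. -/
theorem statement18 (a : ℝ) (ha : a ∈ Set.Ioo (0 : ℝ) 1)
    (pa pb pe : Finpartition (Finset.univ : Finset (Fin 3)))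
    (hpa : pa.parts = {{0, 1, 2}})
    (hpb : pb.parts = {{0, 1}, {2}})
    (hpe : pe.parts = {{0}, {1}, {2}}) :
    tK 1 a pa pb > tK 1 a pa pe ∧ crp (1 : ℝ) pb = crp (1 : ℝ) pe := by
  obtain ⟨ha0, ha1⟩ := ha
  have ha1' : 0 < 1 - a := by linarith
  have hcrp : crp (1 : ℝ) pb = crp (1 : ℝ) pe := by
    unfold crp
    rw [hpb, hpe]
    have h1 : ∏ b ∈ ({{0, 1}, {2}} : Finset (Finset (Fin 3))),
        Nat.factorial (b.card - 1) = 1 := by decide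
    have h2 : ∏ b ∈ ({{0}, {1}, {2}} : Finset (Finset (Fin 3))),
        Nat.factorial (b.card - 1) = 1 := by decide
    have h1' := congrArg (Nat.cast : ℕ → ℝ) h1
    have h2' := congrArg (Nat.cast : ℕ → ℝ) h2
    push_cast at h1' h2'
    rw [h1', h2']
    simp
  refine ⟨?_, hcrp⟩
  have hw : ∀ γ : Fin 3 → Bool, 0 < ∏ i, (if γ i then a else 1 - a) := fun γ =>
    Finset.prod_pos fun i _ => by split_ifs <;> assumption
  unfold tK
  apply Finset.sum_lt_sum
  · intro γ _
    by_cases he : restrictPart pe (gammaSet γ) (Finset.subset_univ _) =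
        restrictPart pa (gammaSet γ) (Finset.subset_univ _)
    · have hb : restrictPart pb (gammaSet γ) (Finset.subset_univ _) =
          restrictPart pa (gammaSet γ) (Finset.subset_univ _) := by
        have he' := congrArg Finpartition.parts he
        apply Finpartition.ext
        rw [restrictPart_parts_aux, restrictPart_parts_aux] at he' ⊢
        rw [hpe, hpa] at he'
        rw [hpb, hpa]
        exact comb_aux _ he'
      rw [he, hb, hcrp]
    · rw [if_neg he, mul_zero, zero_mul]
      refine mul_nonneg (mul_nonneg (hw γ).le (by split_ifs <;> norm_num)) ?_
      exact (div_pos (crp_one_pos_aux _) (crp_one_pos_aux _)).le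
  · refine ⟨![true, true, false], Finset.mem_univ _, ?_⟩
    have hS : gammaSet ![true, true, false] = ({0, 1} : Finset (Fin 3)) := by decide
    rw [if_neg, if_pos, mul_zero, zero_mul, mul_one]
    · exact mul_pos (hw _) (div_pos (crp_one_pos_aux _) (crp_one_pos_aux _))
    · apply Finpartition.ext
      rw [restrictPart_parts_aux, restrictPart_parts_aux, hpb, hpa, hS]
      decide
    · intro h
      have h' := congrArg Finpartition.parts h
      rw [restrictPart_parts_aux, restrictPart_parts_aux, hpe, hpa, hS] at h'
      revert h'
      decide
end
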